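/- arXiv:math/0302229 — 5 statements merged into one kernel-verified Lean document; each statement's English description precedes it below -/
import Mathlib

section
/- Let P be an abelian Lie subalgebra of L. Then the following are equivalent: (a) 2·dim P = dim L + i(L), i.e. P is a commutative polarization of L; (b) there exists f ∈ L* with P^f = P. Moreover, any f ∈ L* satisfying P^f = P is regular. -/
open Module

noncomputable section

variable (k : Type*) [Field k]

/-- `L(f) = {x ∈ L | f ⁅x, y⁆ = 0 for all y ∈ L}`. -/
def lieStab (L : Type*) [LieRing L] [LieAlgebra k L] (f : Module.Dual k L) :
    Submodule k L where
  carrier := {x | ∀ y : L, f ⁅x, y⁆ = 0}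
  add_mem' := fun {a b} ha hb y => by rw [add_lie, map_add, ha y, hb y, add_zero]
  zero_mem' := fun y => by rw [zero_lie, map_zero]
  smul_mem' := fun c a ha y => by rw [smul_lie, map_smul, ha y, smul_zero]

/-- The index `i(L)`, the minimum of `dim L(f)` over all `f ∈ L*`. -/
def lieIndex (L : Type*) [LieRing L] [LieAlgebra k L] : ℕ :=
  ⨅ f : Module.Dual k L, finrank k (lieStab k L f)

/-- `f ∈ L*` is regular if `dim L(f) = i(L)`. -/
def LieIsRegular (L : Type*) [LieRing L] [LieAlgebra k L] (f : Module.Dual k L) : Prop :=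
  finrank k (lieStab k L f) = lieIndex k L

/-- A commutative polarization of `L`: an abelian Lie subalgebra `P` with
`2 dim P = dim L + i(L)`. -/
def IsCP (L : Type*) [LieRing L] [LieAlgebra k L] (P : LieSubalgebra k L) : Prop :=
  IsLieAbelian ↥P ∧ 2 * finrank k ↥P = finrank k L + lieIndex k L

/-- A CP-ideal of `L`: a CP which is also a Lie ideal of `L`. -/
def IsCPIdeal (L : Type*) [LieRing L] [LieAlgebra k L] (P : LieSubalgebra k L) : Prop :=
  IsCP k L P ∧ ∀ x y : L, y ∈ P → ⁅x, y⁆ ∈ P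

/-- `L` is square integrable if `i(L) = dim Z(L)`. -/
def SquareIntegrable (L : Type*) [LieRing L] [LieAlgebra k L] : Prop :=
  lieIndex k L = finrank k ↥(LieAlgebra.center k L)


/-- For a subset/subalgebra `P` of `L` and `f ∈ L*`, the subspace
`P^f = {x ∈ L | f ⁅x, a⁆ = 0 for all a ∈ P}`. -/
def liePerp (L : Type*) [LieRing L] [LieAlgebra k L] (P : LieSubalgebra k L)
    (f : Module.Dual k L) : Submodule k L where
  carrier := {x | ∀ a ∈ P, f ⁅x, a⁆ = 0}
  add_mem' := fun {a b} ha hb y hy => by rw [add_lie, map_add, ha y hy, hb y hy, add_zero]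
  zero_mem' := fun y _ => by rw [zero_lie, map_zero]
  smul_mem' := fun c a ha y hy => by rw [smul_lie, map_smul, ha y hy, smul_zero]

section

variable {k L : Type*} [Field k] [LieRing L] [LieAlgebra k L]

/-- The alternating bilinear form `(x, y) ↦ f ⁅x, y⁆` attached to a linear form `f`. -/
def lieForm (f : Module.Dual k L) : LinearMap.BilinForm k L :=
  (LieModule.toEnd k L L : L →ₗ[k] Module.End k L).compr₂ f

theorem lieForm_apply (f : Module.Dual k L) (x y : L) : lieForm f x y = f ⁅x, y⁆ := rfl

theorem lieForm_isRefl (f : Module.Dual k L) : (lieForm f).IsRefl := by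
  intro x y h
  rw [lieForm_apply] at h ⊢
  rw [← lie_skew, map_neg, h, neg_zero]

theorem orthogonal_lieForm_toSubmodule (P : LieSubalgebra k L) (f : Module.Dual k L) :
    (lieForm f).orthogonal P.toSubmodule = liePerp k L P f := by
  ext x
  exact ⟨fun h a ha => lieForm_isRefl f a x (h a ha),
    fun h a ha => lieForm_isRefl f x a (h a ha)⟩

theorem orthogonal_lieForm_top (f : Module.Dual k L) :
    (lieForm f).orthogonal ⊤ = lieStab k L f := by
  ext x
  exact ⟨fun h a => lieForm_isRefl f a x (h a trivial),
    fun h a _ => lieForm_isRefl f x a (h a)⟩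

theorem finrank_add_finrank_liePerp [FiniteDimensional k L] (P : LieSubalgebra k L)
    (f : Module.Dual k L) :
    finrank k P + finrank k (liePerp k L P f) =
      finrank k L + finrank k ↥(P.toSubmodule ⊓ lieStab k L f) := by
  have h := LinearMap.BilinForm.finrank_add_finrank_orthogonal (lieForm_isRefl f) P.toSubmodule
  rwa [orthogonal_lieForm_toSubmodule, orthogonal_lieForm_top] at h

theorem finrank_add_finrank_liePerp_le [FiniteDimensional k L] (P : LieSubalgebra k L)
    (f : Module.Dual k L) :
    finrank k P + finrank k (liePerp k L P f) ≤ finrank k L + finrank k (lieStab k L f) := by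
  rw [finrank_add_finrank_liePerp]
  exact Nat.add_le_add_left (Submodule.finrank_mono inf_le_right) _

theorem lieStab_le_liePerp (P : LieSubalgebra k L) (f : Module.Dual k L) :
    lieStab k L f ≤ liePerp k L P f :=
  fun _ hx a _ => hx a

theorem le_liePerp_of_isLieAbelian (P : LieSubalgebra k L) (hP : IsLieAbelian ↥P)
    (f : Module.Dual k L) : P.toSubmodule ≤ liePerp k L P f := by
  intro x hx a ha
  have h : ⁅(⟨x, hx⟩ : P), (⟨a, ha⟩ : P)⁆ = 0 := hP.trivial _ _
  have h' : ⁅x, a⁆ = 0 := congrArg Subtype.val h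
  rw [h', map_zero]

theorem two_mul_finrank_le_of_isLieAbelian [FiniteDimensional k L] (P : LieSubalgebra k L)
    (hP : IsLieAbelian ↥P) (f : Module.Dual k L) :
    2 * finrank k P ≤ finrank k L + finrank k (lieStab k L f) := by
  have h₁ : finrank k P ≤ finrank k (liePerp k L P f) :=
    Submodule.finrank_mono (le_liePerp_of_isLieAbelian P hP f)
  have h₂ := finrank_add_finrank_liePerp_le P f
  omega

theorem two_mul_finrank_of_liePerp_eq [FiniteDimensional k L] (P : LieSubalgebra k L)
    {f : Module.Dual k L} (hf : liePerp k L P f = P.toSubmodule) :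
    2 * finrank k P = finrank k L + finrank k (lieStab k L f) := by
  have h := finrank_add_finrank_liePerp P f
  rw [inf_eq_right.mpr (hf ▸ lieStab_le_liePerp P f), hf] at h
  rw [two_mul]
  exact h

theorem exists_lieIsRegular : ∃ f : Module.Dual k L, LieIsRegular k L f :=
  Nat.sInf_mem (Set.range_nonempty fun f : Module.Dual k L => finrank k (lieStab k L f))

theorem lieIsRegular_of_liePerp_eq [FiniteDimensional k L] (P : LieSubalgebra k L)
    (hP : IsLieAbelian ↥P) {f : Module.Dual k L} (hf : liePerp k L P f = P.toSubmodule) :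
    LieIsRegular k L f := by
  refine le_antisymm (le_ciInf fun g => ?_) (ciInf_le (OrderBot.bddBelow _) f)
  have h₁ := two_mul_finrank_of_liePerp_eq P hf
  have h₂ := two_mul_finrank_le_of_isLieAbelian P hP g
  omega

end

/-- **Lemma 1.2.** For an abelian Lie subalgebra `P` of `L`, the following are equivalent:
(a) `2 dim P = dim L + i(L)`, i.e. `P` is a commutative polarization of `L`;
(b) `P^f = P` for some `f ∈ L*`.  Moreover any `f ∈ L*` with `P^f = P` is regular. -/
theorem cp_iff_exists_perp_eq {k L : Type*} [Field k] [CharZero k] [LieRing L]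
    [LieAlgebra k L] [FiniteDimensional k L] (P : LieSubalgebra k L)
    (hP : IsLieAbelian ↥P) :
    (2 * finrank k ↥P = finrank k L + lieIndex k L ↔
      ∃ f : Module.Dual k L, liePerp k L P f = P.toSubmodule) ∧
    ∀ f : Module.Dual k L, liePerp k L P f = P.toSubmodule → LieIsRegular k L f := by
  refine ⟨⟨fun h => ?_, fun ⟨f, hf⟩ => ?_⟩, fun f hf => lieIsRegular_of_liePerp_eq P hP hf⟩
  · obtain ⟨f, hf⟩ := exists_lieIsRegular (k := k) (L := L)
    refine ⟨f, (Submodule.eq_of_le_of_finrank_le (le_liePerp_of_isLieAbelian P hP f) ?_).symm⟩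
    have h' := finrank_add_finrank_liePerp_le P f
    rw [hf] at h'
    change finrank k (liePerp k L P f) ≤ finrank k P
    omega
  · rw [two_mul_finrank_of_liePerp_eq P hf, lieIsRegular_of_liePerp_eq P hP hf]

end
end

section
/- Let M be a Lie subalgebra of L of codimension one, let f ∈ L* and let g ∈ M* be the restriction of f to M. Then: (i) f is regular and i(M) = i(L) + 1 if and only if g is regular (for M) and L(f) ⊆ M; (ii) f is regular and L(f) ⊄ M if and only if g is regular (for M) and i(M) = i(L) − 1. -/
open Module

noncomputable section

variable (k : Type*) [Field k]

section Hyperplane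

variable {k V : Type*} [Field k] [AddCommGroup V] [Module k V]

theorem sub_smul_mem_ker {φ : Module.Dual k V} {z : V} (hz : φ z ≠ 0) (y : V) :
    y - (φ y / φ z) • z ∈ LinearMap.ker φ := by
  simp [div_mul_cancel₀ _ hz]

variable [FiniteDimensional k V]

theorem finrank_inf_ker_add_one (S : Submodule k V) (φ : Module.Dual k V)
    (h : ¬ S ≤ LinearMap.ker φ) :
    finrank k ↥(S ⊓ LinearMap.ker φ) + 1 = finrank k S := by
  have hφ : φ.domRestrict S ≠ 0 := fun h0 => h fun x hx => LinearMap.congr_fun h0 ⟨x, hx⟩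
  rw [← Module.Dual.finrank_ker_add_one_of_ne_zero hφ, LinearMap.ker_domRestrict,
    ← Submodule.finrank_map_subtype_eq, Submodule.map_comap_subtype]

theorem exists_dual_ker_eq_of_finrank_add_one (W : Submodule k V)
    (hW : finrank k W + 1 = finrank k V) : ∃ φ : Module.Dual k V, LinearMap.ker φ = W := by
  have hlt : W < ⊤ := lt_top_iff_ne_top.2 fun h => by
    rw [h, finrank_top] at hW
    omega
  obtain ⟨φ, hφ, hle⟩ := Submodule.exists_le_ker_of_lt_top W hlt
  have := Module.Dual.finrank_ker_add_one_of_ne_zero hφ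
  exact ⟨φ, (Submodule.eq_of_le_of_finrank_eq hle (by omega)).symm⟩

end Hyperplane

section Stabilizer

variable {k L : Type*} [Field k] [LieRing L] [LieAlgebra k L]

theorem mem_lieStab {f : Module.Dual k L} {x : L} :
    x ∈ lieStab k L f ↔ ∀ y : L, f ⁅x, y⁆ = 0 := Iff.rfl

theorem lieIndex_le (f : Module.Dual k L) : lieIndex k L ≤ finrank k (lieStab k L f) :=
  ciInf_le (OrderBot.bddBelow _) f

theorem le_lieIndex {n : ℕ} (h : ∀ f : Module.Dual k L, n ≤ finrank k (lieStab k L f)) :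
    n ≤ lieIndex k L :=
  le_ciInf h

theorem mem_map_lieStab_restrict {M : LieSubalgebra k L} {f : Module.Dual k L} {x : L} :
    x ∈ (lieStab k ↥M (f.comp M.incl.toLinearMap)).map M.toSubmodule.subtype ↔
      x ∈ M ∧ ∀ y ∈ M, f ⁅x, y⁆ = 0 := by
  constructor
  · rintro ⟨x, hx, rfl⟩
    exact ⟨x.2, fun y hy => hx ⟨y, hy⟩⟩
  · rintro ⟨hx, h⟩
    exact ⟨⟨x, hx⟩, fun y => h y y.2, rfl⟩

theorem finrank_map_lieStab_restrict (M : LieSubalgebra k L) (f : Module.Dual k L) :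
    finrank k ((lieStab k ↥M (f.comp M.incl.toLinearMap)).map M.toSubmodule.subtype) =
      finrank k (lieStab k ↥M (f.comp M.incl.toLinearMap)) :=
  Submodule.finrank_map_subtype_eq M.toSubmodule _

variable [FiniteDimensional k L]

/-- The functionals of the form `y ↦ f ⁅x, y⁆` are exactly those vanishing on `L(f)`. -/
theorem exists_lie_eq_of_lieStab_le_ker {f φ : Module.Dual k L}
    (h : lieStab k L f ≤ LinearMap.ker φ) : ∃ x : L, ∀ y : L, f ⁅x, y⁆ = φ y := by
  let B : L →ₗ[k] L →ₗ[k] k := (LieModule.toEnd k L L : L →ₗ[k] L →ₗ[k] L).compr₂ f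
  have hφ : φ ∈ (LinearMap.ker B).dualAnnihilator := by
    rw [Submodule.mem_dualAnnihilator]
    exact fun x hx => h fun y => LinearMap.congr_fun hx y
  rw [LinearMap.dualAnnihilator_ker_eq_range_flip] at hφ
  obtain ⟨x, hx⟩ := hφ
  refine ⟨-x, fun y => ?_⟩
  rw [neg_lie, lie_skew, ← hx]
  rfl

theorem finrank_lieStab_restrict_of_le {M : LieSubalgebra k L}
    (hM : finrank k ↥M + 1 = finrank k L) {f : Module.Dual k L}
    (h : lieStab k L f ≤ M.toSubmodule) :
    finrank k (lieStab k ↥M (f.comp M.incl.toLinearMap)) = finrank k (lieStab k L f) + 1 := by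
  obtain ⟨φ, hφ⟩ := exists_dual_ker_eq_of_finrank_add_one M.toSubmodule hM
  have hmem (x : L) : x ∈ M ↔ φ x = 0 := by
    rw [← LieSubalgebra.mem_toSubmodule, ← hφ, LinearMap.mem_ker]
  obtain ⟨x, hx⟩ := exists_lie_eq_of_lieStab_le_ker (φ := φ) (hφ ▸ h)
  obtain ⟨t, ht⟩ : ∃ t, φ t ≠ 0 := by
    by_contra! h0
    have : M.toSubmodule = ⊤ := eq_top_iff.2 fun y _ => (hmem y).2 (h0 y)
    have h1 : finrank k M.toSubmodule = finrank k L := by rw [this, finrank_top]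
    have h2 : finrank k M.toSubmodule = finrank k ↥M := rfl
    omega
  let ψ : Module.Dual k L := f.comp (LieModule.toEnd k L L t)
  have hψ (y : L) : ψ y = f ⁅t, y⁆ := rfl
  have hinf : (lieStab k ↥M (f.comp M.incl.toLinearMap)).map M.toSubmodule.subtype ⊓
      LinearMap.ker ψ = lieStab k L f := by
    ext y
    rw [Submodule.mem_inf, mem_map_lieStab_restrict, LinearMap.mem_ker, hψ, ← lie_skew, map_neg,
      neg_eq_zero, mem_lieStab]
    refine ⟨fun ⟨⟨_, hyM⟩, hyt⟩ z => ?_, fun hy => ⟨⟨h hy, fun z _ => hy z⟩, hy t⟩⟩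
    have := hyM _ ((hmem _).2 (sub_smul_mem_ker ht z))
    simpa [hyt] using this
  rw [← finrank_map_lieStab_restrict, ← finrank_inf_ker_add_one _ ψ, hinf]
  intro hle
  have hxS : x ∈ (lieStab k ↥M (f.comp M.incl.toLinearMap)).map M.toSubmodule.subtype :=
    mem_map_lieStab_restrict.2 ⟨(hmem x).2 (by rw [← hx, lie_self, map_zero]),
      fun y hy => by rw [hx, (hmem y).1 hy]⟩
  have := hle hxS
  rw [LinearMap.mem_ker, hψ, ← lie_skew, map_neg, neg_eq_zero, hx] at this
  exact ht this

theorem finrank_lieStab_restrict_of_not_le {M : LieSubalgebra k L}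
    (hM : finrank k ↥M + 1 = finrank k L) {f : Module.Dual k L}
    (h : ¬ lieStab k L f ≤ M.toSubmodule) :
    finrank k (lieStab k ↥M (f.comp M.incl.toLinearMap)) + 1 = finrank k (lieStab k L f) := by
  obtain ⟨φ, hφ⟩ := exists_dual_ker_eq_of_finrank_add_one M.toSubmodule hM
  have hmem (x : L) : x ∈ M ↔ φ x = 0 := by
    rw [← LieSubalgebra.mem_toSubmodule, ← hφ, LinearMap.mem_ker]
  obtain ⟨t, htS, ht⟩ := Set.not_subset.1 h
  replace ht : φ t ≠ 0 := fun h0 => ht ((hmem t).2 h0)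
  have hinf : (lieStab k ↥M (f.comp M.incl.toLinearMap)).map M.toSubmodule.subtype =
      lieStab k L f ⊓ LinearMap.ker φ := by
    ext y
    rw [Submodule.mem_inf, mem_map_lieStab_restrict, LinearMap.mem_ker, hmem, mem_lieStab]
    refine ⟨fun ⟨hy, hyM⟩ => ⟨fun z => ?_, hy⟩, fun ⟨hy, hy0⟩ => ⟨hy0, fun z _ => hy z⟩⟩
    have hyt : f ⁅y, t⁆ = 0 := by rw [← lie_skew, map_neg, htS y, neg_zero]
    have := hyM _ ((hmem _).2 (sub_smul_mem_ker ht z))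
    simpa [hyt] using this
  rw [← finrank_map_lieStab_restrict, hinf, finrank_inf_ker_add_one _ φ (hφ ▸ h)]

theorem lieIndex_le_lieIndex_add_one {M : LieSubalgebra k L}
    (hM : finrank k ↥M + 1 = finrank k L) : lieIndex k ↥M ≤ lieIndex k L + 1 := by
  rw [← Nat.sub_le_iff_le_add]
  refine le_lieIndex fun f => ?_
  have := lieIndex_le (f.comp M.incl.toLinearMap)
  by_cases h : lieStab k L f ≤ M.toSubmodule
  · have := finrank_lieStab_restrict_of_le hM h
    omega
  · have := finrank_lieStab_restrict_of_not_le hM h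
    omega

theorem lieIndex_le_lieIndex_subalgebra_add_one {M : LieSubalgebra k L}
    (hM : finrank k ↥M + 1 = finrank k L) : lieIndex k L ≤ lieIndex k ↥M + 1 := by
  rw [← Nat.sub_le_iff_le_add]
  refine le_lieIndex fun g => ?_
  obtain ⟨f, rfl⟩ : ∃ f : Module.Dual k L, f.comp M.incl.toLinearMap = g :=
    LinearMap.exists_extend (p := M.toSubmodule) g
  have := lieIndex_le f
  by_cases h : lieStab k L f ≤ M.toSubmodule
  · have := finrank_lieStab_restrict_of_le hM h
    omega
  · have := finrank_lieStab_restrict_of_not_le hM h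
    omega

end Stabilizer

/-- **Proposition 1.6 (2),(3).** Let `M` be a codimension-one Lie subalgebra of `L`,
`f ∈ L*` and `g = f|_M`.  Then (i) `f` is regular and `i(M) = i(L) + 1` iff `g` is regular
and `L(f) ⊆ M`; (ii) `f` is regular and `L(f) ⊄ M` iff `g` is regular and `i(M) = i(L) - 1`. -/
theorem regular_restriction_codim_one {k L : Type*} [Field k] [CharZero k] [LieRing L]
    [LieAlgebra k L] [FiniteDimensional k L] (M : LieSubalgebra k L)
    (hM : finrank k ↥M + 1 = finrank k L) (f : Module.Dual k L) :
    ((LieIsRegular k L f ∧ lieIndex k ↥M = lieIndex k L + 1) ↔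
      (LieIsRegular k ↥M (f.comp M.incl.toLinearMap) ∧ lieStab k L f ≤ M.toSubmodule)) ∧
    ((LieIsRegular k L f ∧ ¬ lieStab k L f ≤ M.toSubmodule) ↔
      (LieIsRegular k ↥M (f.comp M.incl.toLinearMap) ∧ lieIndex k ↥M + 1 = lieIndex k L)) := by
  have hLM := lieIndex_le_lieIndex_add_one hM
  have hML := lieIndex_le_lieIndex_subalgebra_add_one hM
  have hf := lieIndex_le f
  have hg := lieIndex_le (f.comp M.incl.toLinearMap)
  unfold LieIsRegular
  by_cases h : lieStab k L f ≤ M.toSubmodule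
  · have := finrank_lieStab_restrict_of_le hM h
    simp only [h, not_true_eq_false, and_true, and_false, false_iff, not_and]
    refine ⟨⟨fun ⟨_, _⟩ => ?_, fun _ => ⟨?_, ?_⟩⟩, fun _ => ?_⟩ <;> omega
  · have := finrank_lieStab_restrict_of_not_le hM h
    simp only [h, not_false_eq_true, and_true, and_false, iff_false, not_and]
    refine ⟨fun _ => ?_, fun _ => ⟨?_, ?_⟩, fun ⟨_, _⟩ => ?_⟩ <;> omega

end
end

section
/- Let M be a Lie subalgebra of L of codimension one with i(M) = i(L) − 1, and let H be a CP of L. Then H ∩ M is a CP of M and dim(H ∩ M) = dim H − 1. Moreover, if in addition H is a CP-ideal of L and M is a Lie ideal of L, then H ∩ M is a CP-ideal of M. -/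
open Module

noncomputable section

variable (k : Type*) [Field k]

/-- An abelian subalgebra `P` of `L` is isotropic for the form `(x, y) ↦ f ⁅x, y⁆`, hence
`2 dim P ≤ dim L + dim L(f)`. -/
theorem two_mul_finrank_le_add_finrank_lieStab {k L : Type*} [Field k] [LieRing L]
    [LieAlgebra k L] [FiniteDimensional k L] (f : Module.Dual k L) (P : LieSubalgebra k L)
    [IsLieAbelian ↥P] :
    2 * finrank k ↥P ≤ finrank k L + finrank k (lieStab k L f) := by
  let B : LinearMap.BilinForm k L := (LieModule.toEnd k L L : L →ₗ[k] Module.End k L).compr₂ f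
  have hB (x y : L) : B x y = f ⁅x, y⁆ := rfl
  have hrefl : B.IsRefl := fun x y h => by
    rw [hB] at h ⊢
    rw [← lie_skew, map_neg, h, neg_zero]
  have hdim := LinearMap.BilinForm.finrank_add_finrank_orthogonal hrefl P.toSubmodule
  have hle : P.toSubmodule ≤ B.orthogonal P.toSubmodule := fun x hx y hy => by
    change f ⁅y, x⁆ = 0
    have h : ⁅(⟨y, hy⟩ : P), (⟨x, hx⟩ : P)⁆ = 0 := trivial_lie_zero _ _ _ _
    have hlie : ⁅y, x⁆ = 0 := congrArg Subtype.val h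
    rw [hlie, map_zero]
  have hrad : P.toSubmodule ⊓ B.orthogonal ⊤ ≤ lieStab k L f := fun x hx y =>
    hrefl y x (hx.2 y trivial)
  have h₁ := Submodule.finrank_mono hle
  have h₂ := Submodule.finrank_mono hrad
  change 2 * finrank k P.toSubmodule ≤ _
  omega

/-- An abelian subalgebra `P` of `L` satisfies `2 dim P ≤ dim L + i(L)`. -/
theorem two_mul_finrank_le_add_lieIndex {k L : Type*} [Field k] [LieRing L]
    [LieAlgebra k L] [FiniteDimensional k L] (P : LieSubalgebra k L) [IsLieAbelian ↥P] :
    2 * finrank k ↥P ≤ finrank k L + lieIndex k L := by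
  obtain ⟨f, hf⟩ := Nat.sInf_mem
    (Set.range_nonempty fun f : Module.Dual k L => finrank k (lieStab k L f))
  have hfi : finrank k (lieStab k L f) = lieIndex k L := hf
  exact hfi ▸ two_mul_finrank_le_add_finrank_lieStab f P

/-- A subspace not contained in a hyperplane meets it in codimension one. -/
theorem finrank_inf_add_one_of_not_le {k V : Type*} [Field k] [AddCommGroup V] [Module k V]
    [FiniteDimensional k V] {U W : Submodule k V} (hW : finrank k W + 1 = finrank k V)
    (hU : ¬ U ≤ W) : finrank k ↥(U ⊓ W) + 1 = finrank k U := by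
  have h := Submodule.finrank_sup_add_finrank_inf_eq U W
  have hlt : finrank k W < finrank k ↥(U ⊔ W) :=
    Submodule.finrank_lt_finrank_of_lt (right_lt_sup.mpr hU)
  have hle := Submodule.finrank_le (U ⊔ W)
  omega

/-- Viewing `H ⊓ M` as a subalgebra of `M` does not change its dimension. -/
theorem finrank_comap_incl_inf {k L : Type*} [Field k] [LieRing L] [LieAlgebra k L]
    (H M : LieSubalgebra k L) :
    finrank k ↥(LieSubalgebra.comap M.incl (H ⊓ M)) = finrank k ↥(H ⊓ M) :=
  (Submodule.comapSubtypeEquivOfLe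
    (inf_le_right : H.toSubmodule ⊓ M.toSubmodule ≤ M.toSubmodule)).finrank_eq

/-- The restriction of an abelian subalgebra to `M` is abelian. -/
theorem isLieAbelian_comap_incl_inf {k L : Type*} [Field k] [LieRing L] [LieAlgebra k L]
    (H M : LieSubalgebra k L) [IsLieAbelian ↥H] :
    IsLieAbelian ↥(LieSubalgebra.comap M.incl (H ⊓ M)) where
  trivial x y := by
    have h : ⁅(⟨x.1.1, x.2.1⟩ : H), (⟨y.1.1, y.2.1⟩ : H)⁆ = 0 := trivial_lie_zero _ _ _ _
    have hlie : ⁅x.1.1, y.1.1⁆ = 0 := congrArg Subtype.val h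
    exact Subtype.ext (Subtype.ext hlie)

/-- **Proposition 1.6 (6).** Let `M` be a codimension-one Lie subalgebra of `L` with
`i(M) = i(L) - 1` and `H` a CP of `L`.  Then `H ∩ M` is a CP of `M` with
`dim (H ∩ M) = dim H - 1`; if moreover `H` is a CP-ideal of `L` and `M` is an ideal of `L`,
then `H ∩ M` is a CP-ideal of `M`. -/
theorem cp_inf_codim_one {k L : Type*} [Field k] [CharZero k] [LieRing L]
    [LieAlgebra k L] [FiniteDimensional k L] (M : LieSubalgebra k L)
    (hM : finrank k ↥M + 1 = finrank k L) (hi : lieIndex k ↥M + 1 = lieIndex k L)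
    (H : LieSubalgebra k L) (hH : IsCP k L H) :
    (IsCP k ↥M (LieSubalgebra.comap M.incl (H ⊓ M)) ∧
      finrank k ↥(H ⊓ M) + 1 = finrank k ↥H) ∧
    ((∀ x y : L, y ∈ H → ⁅x, y⁆ ∈ H) → (∀ x y : L, y ∈ M → ⁅x, y⁆ ∈ M) →
      IsCPIdeal k ↥M (LieSubalgebra.comap M.incl (H ⊓ M))) := by
  have := hH.1
  have hdim := hH.2
  have hab := isLieAbelian_comap_incl_inf H M
  have hfin := finrank_comap_incl_inf H M
  have hnle : ¬ H.toSubmodule ≤ M.toSubmodule := fun hle => by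
    have hinf : H ⊓ M = H := inf_eq_left.mpr hle
    have hbound := two_mul_finrank_le_add_lieIndex (LieSubalgebra.comap M.incl (H ⊓ M))
    rw [hfin, hinf] at hbound
    omega
  have hcodim : finrank k ↥(H ⊓ M) + 1 = finrank k ↥H := finrank_inf_add_one_of_not_le hM hnle
  have hCP : IsCP k ↥M (LieSubalgebra.comap M.incl (H ⊓ M)) := ⟨hab, by omega⟩
  exact ⟨⟨hCP, hcodim⟩, fun hHideal _ =>
    ⟨hCP, fun x y hy => ⟨hHideal x y hy.1, ⁅x, y⁆.2⟩⟩⟩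

end
end

section
/- Let P be an abelian Lie ideal of L, let ι : L → U(L) be the canonical embedding of L into its universal enveloping algebra, and let u ∈ U(L), u ≠ 0, be a semi-invariant with weight λ ∈ L*, i.e. ι(x)·u − u·ι(x) = λ(x)·u for all x ∈ L. Then λ(x) = 0 and ι(x)·u = u·ι(x) for every x ∈ P. -/
open Module

noncomputable section

variable (k : Type*) [Field k]

/-- The vectors killed by a power of an operator satisfying the Leibniz rule are closed under
multiplication. -/
theorem pow_apply_mul_eq_zero_of_leibniz {R A : Type*} [CommSemiring R] [Semiring A] [Algebra R A]
    {D : Module.End R A} (hD : ∀ a b, D (a * b) = D a * b + a * D b) (m n : ℕ) (a b : A)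
    (ha : (D ^ m) a = 0) (hb : (D ^ n) b = 0) : (D ^ (m + n)) (a * b) = 0 := by
  induction m generalizing a b n with
  | zero => simp_all
  | succ m ihm =>
    induction n generalizing a b with
    | zero => simp_all
    | succ n ihn =>
      rw [← add_assoc, pow_succ, Module.End.mul_apply, hD, map_add, ihn a (D b) ha
        (by rwa [pow_succ] at hb), add_zero, show m + 1 + n = m + (n + 1) by omega]
      exact ihm (n + 1) (D a) b (by rwa [pow_succ] at ha) hb

/-- If `(ad x) ^ 2 = 0` on `L`, then `ad (ι x)` is locally nilpotent on the enveloping algebra. -/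
theorem UniversalEnvelopingAlgebra.exists_ad_pow_apply_eq_zero {R L : Type*} [CommRing R]
    [LieRing L] [LieAlgebra R L] (x : L) (hx : ∀ y : L, ⁅x, ⁅x, y⁆⁆ = 0)
    (u : UniversalEnvelopingAlgebra R L) :
    ∃ n : ℕ, ((LinearMap.mulLeft R (UniversalEnvelopingAlgebra.ι R x)
      - LinearMap.mulRight R (UniversalEnvelopingAlgebra.ι R x)) ^ n) u = 0 := by
  set D : Module.End R (UniversalEnvelopingAlgebra R L) :=
    LinearMap.mulLeft R (UniversalEnvelopingAlgebra.ι R x)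
      - LinearMap.mulRight R (UniversalEnvelopingAlgebra.ι R x) with hDdef
  have hD : ∀ a b, D (a * b) = D a * b + a * D b := fun a b => by
    simp only [hDdef, LinearMap.sub_apply, LinearMap.mulLeft_apply, LinearMap.mulRight_apply]
    noncomm_ring
  have hι : ∀ y : L, D (UniversalEnvelopingAlgebra.ι R y)
      = UniversalEnvelopingAlgebra.ι R ⁅x, y⁆ := fun y => by
    let := LieRing.ofAssociativeRing (A := UniversalEnvelopingAlgebra R L)
    rw [LieHom.map_lie, LieRing.of_associative_ring_bracket]
    rfl
  obtain ⟨t, rfl⟩ : ∃ t, UniversalEnvelopingAlgebra.mkAlgHom R L t = u :=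
    RingCon.mkₐ_surjective _ u
  induction t using TensorAlgebra.induction with
  | algebraMap r =>
    refine ⟨1, ?_⟩
    simp [hDdef, Algebra.commutes]
  | ι y =>
    refine ⟨2, ?_⟩
    change (D ^ 2) (UniversalEnvelopingAlgebra.ι R y) = 0
    rw [pow_two, Module.End.mul_apply, hι, hι, hx, map_zero]
  | mul a b ha hb =>
    obtain ⟨m, hm⟩ := ha
    obtain ⟨n, hn⟩ := hb
    exact ⟨m + n, by rw [map_mul]; exact pow_apply_mul_eq_zero_of_leibniz hD m n _ _ hm hn⟩
  | add a b ha hb =>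
    obtain ⟨m, hm⟩ := ha
    obtain ⟨n, hn⟩ := hb
    refine ⟨m + n, ?_⟩
    rw [map_add, map_add, pow_add, Module.End.mul_apply, Module.End.mul_apply, hn, map_zero,
      add_zero, ← Module.End.mul_apply, ← pow_add, add_comm m n, pow_add, Module.End.mul_apply,
      hm, map_zero]

/-- **Corollary 4.4 (part of 3).** Let `P` be an abelian Lie ideal of `L`, `ι` the canonical
embedding of `L` in its enveloping algebra `U(L)` and `u ≠ 0` a semi-invariant of `U(L)` with
weight `λ`.  Then `λ` vanishes on `P` and `u` commutes with `ι(x)` for every `x ∈ P`. -/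
theorem semiInvariant_commutes_with_abelian_ideal {k L : Type*} [Field k] [CharZero k]
    [LieRing L] [LieAlgebra k L] [FiniteDimensional k L] (P : LieSubalgebra k L)
    (hPab : IsLieAbelian ↥P) (hPideal : ∀ x y : L, y ∈ P → ⁅x, y⁆ ∈ P)
    (u : UniversalEnvelopingAlgebra k L) (hu : u ≠ 0) (lam : Module.Dual k L)
    (hsemi : ∀ x : L, UniversalEnvelopingAlgebra.ι k x * u - u * UniversalEnvelopingAlgebra.ι k x
      = lam x • u) :
    ∀ x ∈ P, lam x = 0 ∧
      UniversalEnvelopingAlgebra.ι k x * u = u * UniversalEnvelopingAlgebra.ι k x := by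
  intro x hx
  have hsq : ∀ y : L, ⁅x, ⁅x, y⁆⁆ = 0 := fun y =>
    congrArg Subtype.val (hPab.trivial ⟨x, hx⟩ ⟨⁅x, y⁆, by
      rw [← lie_skew]; exact P.neg_mem (hPideal y x hx)⟩)
  obtain ⟨n, hn⟩ := UniversalEnvelopingAlgebra.exists_ad_pow_apply_eq_zero x hsq u
  set D : Module.End k (UniversalEnvelopingAlgebra k L) :=
    LinearMap.mulLeft k (UniversalEnvelopingAlgebra.ι k x)
      - LinearMap.mulRight k (UniversalEnvelopingAlgebra.ι k x)
  have hDu : D u = lam x • u := hsemi x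
  have hpow : ∀ m : ℕ, (D ^ m) u = lam x ^ m • u := fun m => by
    induction m with
    | zero => simp
    | succ m ih => rw [pow_succ, Module.End.mul_apply, hDu, map_smul, ih, smul_smul, pow_succ']
  have hlam : lam x = 0 :=
    eq_zero_of_pow_eq_zero ((smul_eq_zero.mp ((hpow n).symm.trans hn)).resolve_right hu)
  exact ⟨hlam, sub_eq_zero.mp (by rw [hsemi x, hlam, zero_smul])⟩

end
end

section
/- Let V be an abelian Lie ideal of L and let g be a Lie subalgebra of L such that L = g ⊕ V as vector spaces, with dim g ≤ dim V. For f in the dual space V* set g(f) = {x ∈ g : f(⁅x,v⁆) = 0 for all v ∈ V} (note ⁅x,v⁆ ∈ V since V is an ideal). Then the following are equivalent: (1) V is a CP-ideal of L; (2) i(L) = dim V − dim g; (3) g(f) = 0 for some f ∈ V*. -/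
open Module

noncomputable section

variable (k : Type*) [Field k]

/-- The pairing `(x, v) ↦ F ⁅x, v⁆` between a subalgebra `g` and a subalgebra `V`. -/
def liePairing {k L : Type*} [Field k] [LieRing L] [LieAlgebra k L]
    (V g : LieSubalgebra k L) (F : Module.Dual k L) : ↥g →ₗ[k] ↥V →ₗ[k] k :=
  LinearMap.mk₂ k (fun x v => F ⁅(x : L), (v : L)⁆)
    (by simp) (by simp) (by simp) (by simp)

section SemidirectProduct

variable {k L : Type*} [Field k] [LieRing L] [LieAlgebra k L] {V g : LieSubalgebra k L}

@[simp]
theorem liePairing_apply (F : Module.Dual k L) (x : ↥g) (v : ↥V) :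
    liePairing V g F x v = F ⁅(x : L), (v : L)⁆ := rfl

theorem exists_add_of_sup_eq_top (hsup : g.toSubmodule ⊔ V.toSubmodule = ⊤) (y : L) :
    ∃ x ∈ g, ∃ v ∈ V, x + v = y :=
  Submodule.mem_sup.1 (hsup ▸ Submodule.mem_top : y ∈ g.toSubmodule ⊔ V.toSubmodule)

theorem IsLieAbelian.lie_eq_zero_of_mem (hVab : IsLieAbelian ↥V) {v w : L}
    (hv : v ∈ V) (hw : w ∈ V) : ⁅v, w⁆ = 0 :=
  congrArg Subtype.val (hVab.trivial ⟨v, hv⟩ ⟨w, hw⟩)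

/-- An element of an abelian complement `V` of `g` stabilizes `F` as soon as it pairs trivially
with `g`. -/
theorem map_ker_liePairing_flip_le (hVab : IsLieAbelian ↥V)
    (hsup : g.toSubmodule ⊔ V.toSubmodule = ⊤) (F : Module.Dual k L) :
    (LinearMap.ker (liePairing V g F).flip).map V.toSubmodule.subtype ≤ lieStab k L F := by
  rintro _ ⟨v, hv, rfl⟩ y
  obtain ⟨x, hx, w, hw, rfl⟩ := exists_add_of_sup_eq_top hsup y
  have h : F ⁅x, (v : L)⁆ = 0 := LinearMap.congr_fun (LinearMap.mem_ker.1 hv) ⟨x, hx⟩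
  change F ⁅(v : L), x + w⁆ = 0
  rw [lie_add, hVab.lie_eq_zero_of_mem v.2 hw, add_zero, ← lie_skew, map_neg, h, neg_zero]

theorem finrank_map_ker_liePairing_flip (F : Module.Dual k L) :
    finrank k ((LinearMap.ker (liePairing V g F).flip).map V.toSubmodule.subtype) =
      finrank k (LinearMap.ker (liePairing V g F).flip) :=
  (Submodule.equivMapOfInjective V.toSubmodule.subtype
    V.toSubmodule.injective_subtype _).finrank_eq.symm

variable [FiniteDimensional k L]

theorem finrank_ker_liePairing_flip_le (hVab : IsLieAbelian ↥V)
    (hsup : g.toSubmodule ⊔ V.toSubmodule = ⊤) (F : Module.Dual k L) :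
    finrank k (LinearMap.ker (liePairing V g F).flip) ≤ finrank k (lieStab k L F) := by
  have h := Submodule.finrank_mono (map_ker_liePairing_flip_le hVab hsup F)
  rwa [finrank_map_ker_liePairing_flip] at h

theorem finrank_le_finrank_lieStab_add (hVab : IsLieAbelian ↥V)
    (hsup : g.toSubmodule ⊔ V.toSubmodule = ⊤) (F : Module.Dual k L) :
    finrank k ↥V ≤ finrank k (lieStab k L F) + finrank k ↥g := by
  have h₁ := (liePairing V g F).flip.finrank_range_add_finrank_ker
  have h₂ := Submodule.finrank_le (LinearMap.range (liePairing V g F).flip)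
  have h₃ := finrank_ker_liePairing_flip_le hVab hsup F
  have h₄ : finrank k (↥g →ₗ[k] k) = finrank k ↥g := Subspace.dual_finrank_eq
  omega

/-- The stabilizer has the minimal possible dimension `dim V - dim g` exactly when no nonzero
element of `g` pairs trivially with `V`. -/
theorem finrank_lieStab_add_eq_iff (hVab : IsLieAbelian ↥V)
    (hsup : g.toSubmodule ⊔ V.toSubmodule = ⊤) (F : Module.Dual k L) :
    finrank k (lieStab k L F) + finrank k ↥g = finrank k ↥V ↔
      Function.Injective (liePairing V g F) := by
  have h₁ := (liePairing V g F).flip.finrank_range_add_finrank_ker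
  have h₂ := Submodule.finrank_le (LinearMap.range (liePairing V g F).flip)
  have h₃ := finrank_ker_liePairing_flip_le hVab hsup F
  have h₄ : finrank k (↥g →ₗ[k] k) = finrank k ↥g := Subspace.dual_finrank_eq
  constructor
  · intro h
    rw [← LinearMap.flip_surjective_iff₁, ← LinearMap.range_eq_top]
    apply Submodule.eq_top_of_finrank_eq
    omega
  · intro h
    have hle : lieStab k L F ≤
        (LinearMap.ker (liePairing V g F).flip).map V.toSubmodule.subtype := by
      intro y hy
      obtain ⟨x, hx, w, hw, rfl⟩ := exists_add_of_sup_eq_top hsup y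
      have hx0 : (⟨x, hx⟩ : ↥g) = 0 := by
        apply h
        ext v
        have hv : F ⁅x + w, (v : L)⁆ = 0 := hy v
        rw [add_lie, hVab.lie_eq_zero_of_mem hw v.2, add_zero] at hv
        simpa using hv
      obtain rfl : x = 0 := congrArg Subtype.val hx0
      refine ⟨⟨w, hw⟩, ?_, by simp⟩
      refine LinearMap.mem_ker.2 (LinearMap.ext fun z => ?_)
      have hz : F ⁅0 + w, (z : L)⁆ = 0 := hy z
      rw [zero_add, ← lie_skew, map_neg, neg_eq_zero] at hz
      exact hz
    have h₅ := Submodule.finrank_mono hle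
    rw [finrank_map_ker_liePairing_flip] at h₅
    have h₆ : finrank k (LinearMap.range (liePairing V g F).flip) = finrank k (↥g →ₗ[k] k) := by
      rw [LinearMap.range_eq_top.2 (LinearMap.flip_surjective_iff₁.2 h), finrank_top]
    omega

theorem lieIndex_add_finrank_eq_iff (hVab : IsLieAbelian ↥V)
    (hsup : g.toSubmodule ⊔ V.toSubmodule = ⊤) :
    lieIndex k L + finrank k ↥g = finrank k ↥V ↔
      ∃ F : Module.Dual k L, Function.Injective (liePairing V g F) := by
  obtain ⟨F₀, hF₀⟩ : lieIndex k L ∈ Set.range fun F : Module.Dual k L =>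
    finrank k (lieStab k L F) := Nat.sInf_mem (Set.range_nonempty _)
  constructor
  · intro h
    exact ⟨F₀, (finrank_lieStab_add_eq_iff hVab hsup F₀).1 (by rw [← h, ← hF₀])⟩
  · rintro ⟨F, hF⟩
    have h₁ := (finrank_lieStab_add_eq_iff hVab hsup F).2 hF
    have h₂ : lieIndex k L ≤ finrank k (lieStab k L F) := Nat.sInf_le ⟨F, rfl⟩
    have h₃ := finrank_le_finrank_lieStab_add hVab hsup F₀
    dsimp only at hF₀
    omega

end SemidirectProduct

/-- **Proposition 4.6 / Corollary 4.8.** Let `V` be an abelian Lie ideal of `L` and `g` a Lie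
subalgebra with `L = g ⊕ V` and `dim g ≤ dim V`.  For `f ∈ V*` let
`g(f) = {x ∈ g | f(⁅x,v⁆) = 0 for all v ∈ V}`.  The following are equivalent:
(1) `V` is a CP-ideal of `L`; (2) `i(L) = dim V - dim g`; (3) `g(f) = 0` for some `f ∈ V*`. -/
theorem cpIdeal_semidirect_iff {k L : Type*} [Field k] [CharZero k]
    [LieRing L] [LieAlgebra k L] [FiniteDimensional k L]
    (V g : LieSubalgebra k L) (hVab : IsLieAbelian ↥V)
    (hVid : ∀ x y : L, y ∈ V → ⁅x, y⁆ ∈ V)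
    (hinf : g.toSubmodule ⊓ V.toSubmodule = ⊥)
    (hsup : g.toSubmodule ⊔ V.toSubmodule = ⊤)
    (hdim : finrank k ↥g ≤ finrank k ↥V) :
    (IsCPIdeal k L V ↔ lieIndex k L + finrank k ↥g = finrank k ↥V) ∧
    (IsCPIdeal k L V ↔
      ∃ f : Module.Dual k ↥V, ∀ x : L, x ∈ g →
        (∀ v : ↥V, f ⟨⁅x, (v : L)⁆, hVid x (v : L) v.2⟩ = 0) → x = 0) := by
  have hrank : finrank k ↥g + finrank k ↥V = finrank k L := by
    have h := Submodule.finrank_sup_add_finrank_inf_eq g.toSubmodule V.toSubmodule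
    rw [hinf, hsup, finrank_top, finrank_bot, add_zero] at h
    exact h.symm
  have hCP : IsCPIdeal k L V ↔ lieIndex k L + finrank k ↥g = finrank k ↥V := by
    refine ⟨fun h => ?_, fun h => ⟨⟨hVab, ?_⟩, hVid⟩⟩
    · have := h.1.2
      omega
    · omega
  refine ⟨hCP, hCP.trans ((lieIndex_add_finrank_eq_iff hVab hsup).trans ⟨?_, ?_⟩)⟩
  · rintro ⟨F, hF⟩
    refine ⟨F ∘ₗ V.toSubmodule.subtype, fun x hx h => ?_⟩
    have hx0 : (⟨x, hx⟩ : ↥g) = 0 := by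
      apply hF
      refine LinearMap.ext fun v => ?_
      rw [map_zero]
      exact h v
    exact congrArg Subtype.val hx0
  · rintro ⟨f, hf⟩
    obtain ⟨F, hF⟩ := LinearMap.exists_extend (p := V.toSubmodule) f
    refine ⟨F, (injective_iff_map_eq_zero _).2 fun x hx => Subtype.ext (hf x x.2 fun v => ?_)⟩
    have h : F ⁅(x : L), (v : L)⁆ = 0 := LinearMap.congr_fun hx v
    rw [← hF]
    exact h

end
end
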